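/- arXiv:1712.08499 — 2 statements merged into one kernel-verified Lean document; each statement's English description precedes it below -/
import Mathlib

section
/- Let 𝒳 be a set, f_x : 𝒳 → ℝ^p, μ : 𝒳 → ℝ with μ > 0 on 𝒳, and let Ψ map p×p real matrices to [0, ∞) and satisfy the homogeneity property Ψ(cA) = c^{−s} Ψ(A) for some s > 0, all c > 0 and all matrices A (satisfied by the D-criterion |M^{−1}|^{1/p} and the A-criterion Tr(M^{−1})). Fix points x*_1, …, x*_d ∈ 𝒳 and a probability weight vector w* that minimizes ξ ↦ Ψ(M(ξ)) over all finitely supported designs ξ on 𝒳, attaining the minimum at the design ξ* with points x*_i and weights w*_i. Let ω be a probability weight vector on x*_1, …, x*_d, let m > 0 and Q ≥ 0 with m + Q > 0, and define w'_i = w*_i + Q(w*_i − ω_i)/m. If w'_i ∈ [0, 1] for all i, then the design λ' with points x*_i and weights w'_i minimizes λ ↦ Ψ(m M(λ) + Q M(τ)) over all finitely supported designs λ on 𝒳, where τ is the design with points x*_i and weights ω_i. (This is the paper's claim that λ'_j(θ) solves the run-level optimization problem (19)/(14) whenever λ'_j(θ) ∈ Ξ_Δ.) -/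
open Finset

/-- A conic combination of two finite weighted sums of `G` is a rescaled weighted sum over the
concatenated points, the weights being the normalized mixture. -/
theorem smul_sum_add_smul_sum_eq_smul_sum_append {𝒳 E : Type*} [AddCommGroup E] [Module ℝ E]
    (μ : 𝒳 → ℝ) (G : 𝒳 → E) {a b : ℝ} (hab : a + b ≠ 0) {k d : ℕ} (x : Fin k → 𝒳)
    (y : Fin d → 𝒳) (u : Fin k → ℝ) (v : Fin d → ℝ) :
    a • (∑ i, (u i * μ (x i)) • G (x i)) + b • (∑ i, (v i * μ (y i)) • G (y i)) =
      (a + b) • ∑ i, (Fin.append (fun i => a / (a + b) * u i) (fun i => b / (a + b) * v i) i *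
        μ (Fin.append x y i)) • G (Fin.append x y i) := by
  simp only [Fin.sum_univ_add, Fin.append_left, Fin.append_right, smul_add, Finset.smul_sum,
    smul_smul]
  congr 1 <;> refine Finset.sum_congr rfl fun i _ => ?_ <;> congr 1 <;> field_simp

/-- if the optimal weights `w*` minimize `Ψ(M(ξ))` over all finitely
supported designs on `𝒳`, `Ψ` is homogeneous of degree `−s`, and the LOAD allocation
`w'_i = w*_i + Q(w*_i − ω_i)/m` lies in `[0,1]` for all `i`, then the design `λ'` with
points `x*_i` and weights `w'_i` minimizes `λ ↦ Ψ(m M(λ) + Q M(τ))` over all finitely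
supported designs `λ` on `𝒳`, where `τ` has points `x*_i` and weights `ω_i`. -/
theorem load_allocation_is_optimal
    {𝒳 : Type*} (p : ℕ) (fx : 𝒳 → Fin p → ℝ) (μ : 𝒳 → ℝ) (hμ : ∀ x, 0 < μ x)
    (Ψ : Matrix (Fin p) (Fin p) ℝ → ℝ) (hΨnn : ∀ A, 0 ≤ Ψ A)
    (s : ℝ) (hs : 0 < s)
    (hhom : ∀ (c : ℝ), 0 < c → ∀ A : Matrix (Fin p) (Fin p) ℝ,
      Ψ (c • A) = c ^ (-s) * Ψ A)
    (d : ℕ) (xstar : Fin d → 𝒳) (wstar : Fin d → ℝ)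
    (hwnn : ∀ i, 0 ≤ wstar i) (hwsum : ∑ i, wstar i = 1)
    -- `w*` minimizes `Ψ(M(ξ))` over all finitely supported designs `ξ` on `𝒳`
    (hopt : ∀ (k : ℕ) (pts : Fin k → 𝒳) (u : Fin k → ℝ),
      (∀ l, 0 ≤ u l) → (∑ l, u l = 1) →
      Ψ (∑ i, (wstar i * μ (xstar i)) • Matrix.vecMulVec (fx (xstar i)) (fx (xstar i)))
        ≤ Ψ (∑ l, (u l * μ (pts l)) • Matrix.vecMulVec (fx (pts l)) (fx (pts l))))
    (ω : Fin d → ℝ) (hωnn : ∀ i, 0 ≤ ω i) (hωsum : ∑ i, ω i = 1)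
    (m Q : ℝ) (hm : 0 < m) (hQ : 0 ≤ Q) (hmQ : 0 < m + Q)
    (w' : Fin d → ℝ) (hw' : ∀ i, w' i = wstar i + Q * (wstar i - ω i) / m)
    (h01 : ∀ i, w' i ∈ Set.Icc (0 : ℝ) 1) :
    ∀ (k : ℕ) (pts : Fin k → 𝒳) (u : Fin k → ℝ),
      (∀ l, 0 ≤ u l) → (∑ l, u l = 1) →
      Ψ (m • (∑ i, (w' i * μ (xstar i)) • Matrix.vecMulVec (fx (xstar i)) (fx (xstar i)))
          + Q • (∑ i, (ω i * μ (xstar i)) • Matrix.vecMulVec (fx (xstar i)) (fx (xstar i))))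
        ≤ Ψ (m • (∑ l, (u l * μ (pts l)) • Matrix.vecMulVec (fx (pts l)) (fx (pts l)))
          + Q • (∑ i, (ω i * μ (xstar i)) • Matrix.vecMulVec (fx (xstar i)) (fx (xstar i)))) := by
  intro k pts u hu husum
  have hc : m + Q ≠ 0 := hmQ.ne'
  have hload : m • (∑ i, (w' i * μ (xstar i)) •
        Matrix.vecMulVec (fx (xstar i)) (fx (xstar i))) +
      Q • (∑ i, (ω i * μ (xstar i)) • Matrix.vecMulVec (fx (xstar i)) (fx (xstar i))) =
      (m + Q) • ∑ i, (wstar i * μ (xstar i)) •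
        Matrix.vecMulVec (fx (xstar i)) (fx (xstar i)) := by
    simp only [Finset.smul_sum, smul_smul, ← Finset.sum_add_distrib, ← add_smul]
    refine Finset.sum_congr rfl fun i _ => ?_
    rw [hw' i]
    congr 1
    field_simp
    ring
  rw [hload, smul_sum_add_smul_sum_eq_smul_sum_append μ
    (fun x => Matrix.vecMulVec (fx x) (fx x)) hc, hhom _ hmQ, hhom _ hmQ]
  refine mul_le_mul_of_nonneg_left (hopt _ _ _ (fun l => ?_) ?_) (Real.rpow_nonneg hmQ.le _)
  · refine Fin.addCases (fun i => ?_) (fun i => ?_) l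
    · rw [Fin.append_left]
      exact mul_nonneg (div_nonneg hm.le hmQ.le) (hu i)
    · rw [Fin.append_right]
      exact mul_nonneg (div_nonneg hQ hmQ.le) (hωnn i)
  · simp only [Fin.sum_univ_add, Fin.append_left, Fin.append_right, ← Finset.mul_sum, husum,
      hωsum]
    field_simp
end

section
/- Deterministic version of the Appendix Lemma: Fix 0 < c_0 ≤ c_3, an integer m_max ≥ 1, d ≥ 1, and target weights w*_i > 0 with ∑_{i=1}^d w*_i = 1. Consider a sequence of runs j = 1, 2, …, with run sizes 1 ≤ m_j ≤ m_max and integer allocations m_{ij} ∈ {0, …, m_j}, ∑_i m_{ij} = m_j. Each observation at point i contributes a value z ∈ [c_0, c_3]. Suppose the allocation rule satisfies m_{ij} = 0 whenever w'_{ij} ≤ 0, where w'_{ij} = w*_i + Q_{j−1}(w*_i − ω_{i,j−1})/m_j, Q_{j−1} is the total of all contributed values in the first j − 1 runs and ω_{i,j−1} the fraction thereof at point i. Then there exist constants C and N, depending only on d, min_i w*_i, m_max, c_0, c_3, such that for every J with total sample size n = ∑_{j≤J} m_j ≥ N, every i satisfies |ω_{i,J} − w*_i| ≤ C/n. -/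
open Finset

/-- Extending a partial sum of terms bounded above by `c` by `r` terms adds at most `c * r`. -/
theorem sum_range_add_le_add_mul {z : ℕ → ℝ} {c : ℝ} (hz : ∀ k, z k ≤ c) (n r : ℕ) :
    ∑ k ∈ range (n + r), z k ≤ ∑ k ∈ range n, z k + c * r := by
  rw [sum_range_add]
  have h := sum_le_card_nsmul (range r) (fun k => z (n + k)) c fun k _ => hz _
  rw [card_range, nsmul_eq_mul] at h
  linarith

/-- Real numbers that sum to zero and are all at most `K` are at most `card ι * K` in absolute
value. -/
theorem abs_le_card_mul_of_sum_eq_zero {ι : Type*} [Fintype ι] {D : ι → ℝ} {K : ℝ}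
    (hK : 0 ≤ K) (hD : ∀ i, D i ≤ K) (hsum : ∑ i, D i = 0) (i : ι) :
    |D i| ≤ Fintype.card ι * K := by
  classical
  have hcard : (1 : ℝ) ≤ Fintype.card ι := by
    exact_mod_cast Fintype.card_pos_iff.mpr ⟨i⟩
  have hsingle := single_le_sum (f := fun k => K - D k)
    (fun k _ => sub_nonneg.mpr (hD k)) (mem_univ i)
  simp only [sum_sub_distrib, hsum, sum_const, card_univ, nsmul_eq_mul] at hsingle
  rw [abs_le]
  constructor <;> nlinarith [hD i]

/-- deterministic version of the Appendix Lemma: if every observation's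
information value lies in `[c_0, c_3]` with `c_0 > 0` and the LOAD-type allocation rule
is followed (no observations at points with nonpositive LOAD weight `w'_{ij}`), then
there are constants `C`, `N` depending only on `d`, `min_i w*_i`, `m_max`, `c_0`, `c_3`
such that for all `J` with total sample size `n = ∑_{j≤J} m_j ≥ N`,
`|ω_{i,J} − w*_i| ≤ C/n` for every `i`. -/
theorem load_deterministic_rate
    (d mmax : ℕ) (hd : 1 ≤ d) (hmmax : 1 ≤ mmax)
    (c0 c3 : ℝ) (hc0 : 0 < c0) (hc03 : c0 ≤ c3)
    (wmin : ℝ) (hwmin : 0 < wmin) :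
    ∃ (C : ℝ) (Nbd : ℕ),
      ∀ (wstar : Fin d → ℝ), (∀ i, wmin ≤ wstar i) → (∑ i, wstar i = 1) →
      ∀ (m : ℕ → ℕ), (∀ j, 1 ≤ m j ∧ m j ≤ mmax) →
      ∀ (mij : Fin d → ℕ → ℕ), (∀ j, ∑ i, mij i j = m j) →
      ∀ (z : Fin d → ℕ → ℝ), (∀ i k, z i k ∈ Set.Icc c0 c3) →
      -- cumulative number of observations at point `i` after the first `j` runs
      ∀ (N : Fin d → ℕ → ℕ), (∀ i j, N i j = ∑ k ∈ Finset.range j, mij i k) →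
      -- cumulative information at point `i` after the first `j` runs
      ∀ (T : Fin d → ℕ → ℝ), (∀ i j, T i j = ∑ k ∈ Finset.range (N i j), z i k) →
      -- total accumulated information after the first `j` runs
      ∀ (Qt : ℕ → ℝ), (∀ j, Qt j = ∑ i, T i j) →
      -- the LOAD allocation weight of point `i` at run `j`
      ∀ (w' : Fin d → ℕ → ℝ),
        (∀ i j, w' i j = wstar i + Qt j * (wstar i - T i j / Qt j) / (m j : ℝ)) →
      -- no observations at points with nonpositive LOAD weight
      (∀ i j, w' i j ≤ 0 → mij i j = 0) →
      ∀ J : ℕ, Nbd ≤ ∑ j ∈ Finset.range J, m j →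
        ∀ i, |T i J / Qt J - wstar i| ≤ C / ((∑ j ∈ Finset.range J, m j : ℕ) : ℝ) := by
  refine ⟨d * (mmax + c3 * mmax) / c0, 1, ?_⟩
  intro w hw hwsum m hm mij hmij z hz N hN T hT Q hQ w' hw' hrule J hJ i
  have hc3 : 0 < c3 := hc0.trans_le hc03
  have hw0 : ∀ i, 0 < w i := fun i => hwmin.trans_le (hw i)
  have hw1 : ∀ i, w i ≤ 1 := fun i =>
    hwsum ▸ single_le_sum (fun k _ => (hw0 k).le) (mem_univ i)
  have hNsucc : ∀ i j, N i (j + 1) = N i j + mij i j := fun i j => by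
    rw [hN, hN, sum_range_succ]
  have hTmono : ∀ i j, T i j ≤ T i (j + 1) := fun i j => by
    rw [hT, hT, hNsucc, sum_range_add]
    exact le_add_of_nonneg_right (sum_nonneg fun k _ => hc0.le.trans (hz i _).1)
  have hTsucc : ∀ i j, T i (j + 1) ≤ T i j + c3 * mij i j := fun i j => by
    rw [hT, hT, hNsucc]
    exact sum_range_add_le_add_mul (fun k => (hz i k).2) _ _
  have hT0 : ∀ i j, 0 ≤ T i j := fun i j => by
    rw [hT]
    exact sum_nonneg fun k _ => hc0.le.trans (hz i k).1
  have hQmono : ∀ j, Q j ≤ Q (j + 1) := fun j => by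
    rw [hQ, hQ]
    exact sum_le_sum fun i _ => hTmono i j
  have hTQ : ∀ i j, T i j ≤ Q j := fun i j => by
    rw [hQ]
    exact single_le_sum (fun k _ => hT0 k j) (mem_univ i)
  have hK : (0 : ℝ) ≤ mmax + c3 * mmax := by positivity
  have hupper : ∀ j i, T i j - w i * Q j ≤ mmax + c3 * mmax := by
    intro j
    induction j with
    | zero =>
      intro i
      have hzero : ∀ i, T i 0 = 0 := fun i => by simp [hT, hN]
      have hQzero : Q 0 = 0 := by simp [hQ, hzero]
      rw [hzero, hQzero]
      simpa using hK
    | succ j ih =>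
      intro i
      have hm0 : (0 : ℝ) < m j := by exact_mod_cast (hm j).1
      have hmle : (m j : ℝ) ≤ mmax := by exact_mod_cast (hm j).2
      have hQw : w i * Q j ≤ w i * Q (j + 1) :=
        mul_le_mul_of_nonneg_left (hQmono j) (hw0 i).le
      have hstep := hTsucc i j
      by_cases h : w i * m j ≤ T i j - w i * Q j
      · have hQpos : 0 < Q j := by
          refine lt_of_le_of_ne ((hT0 i j).trans (hTQ i j)) fun h0 => ?_
          have := hTQ i j
          rw [← h0] at h this
          nlinarith [mul_pos (hw0 i) hm0]
        have hle : w' i j ≤ 0 := by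
          have heq : w' i j = (w i * m j - (T i j - w i * Q j)) / m j := by
            rw [hw']
            field_simp
            ring
          rw [heq]
          exact div_nonpos_of_nonpos_of_nonneg (by linarith) hm0.le
        rw [hrule i j hle] at hstep
        have := ih i
        push_cast at hstep
        linarith
      · have hmijle : (mij i j : ℝ) ≤ mmax := by
          have : mij i j ≤ m j :=
            hmij j ▸ single_le_sum (f := fun i => mij i j) (fun k _ => Nat.zero_le _) (mem_univ i)
          exact_mod_cast this.trans (hm j).2
        have hwm : w i * m j ≤ mmax := by nlinarith [hw1 i]
        have := mul_le_mul_of_nonneg_left hmijle hc3.le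
        linarith
  have hsum : ∑ i, (T i J - w i * Q J) = 0 := by
    rw [sum_sub_distrib, ← hQ, ← sum_mul, hwsum, one_mul, sub_self]
  have habs := abs_le_card_mul_of_sum_eq_zero hK (hupper J) hsum i
  rw [Fintype.card_fin] at habs
  have hNsum : ∑ i, N i J = ∑ j ∈ range J, m j := by
    simp only [hN]
    rw [sum_comm]
    exact sum_congr rfl fun j _ => hmij j
  have hQlow : c0 * ((∑ j ∈ range J, m j : ℕ) : ℝ) ≤ Q J := by
    rw [hQ, ← hNsum, Nat.cast_sum, mul_sum]
    refine sum_le_sum fun i _ => ?_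
    rw [hT]
    simpa [mul_comm] using card_nsmul_le_sum (range (N i J)) (z i) c0 fun k _ => (hz i k).1
  have hn : (0 : ℝ) < ((∑ j ∈ range J, m j : ℕ) : ℝ) := by exact_mod_cast hJ
  have hQpos : 0 < Q J := (mul_pos hc0 hn).trans_le hQlow
  have heq : T i J / Q J - w i = (T i J - w i * Q J) / Q J := by
    field_simp
  rw [heq, abs_div, abs_of_pos hQpos, div_div]
  exact div_le_div₀ (mul_nonneg (Nat.cast_nonneg d) hK) habs (mul_pos hc0 hn) hQlow
end
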